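/- Let (R, 𝔪) be a local Noetherian ring, 𝔞 an ideal, M a nonzero finitely generated R-module of dimension d with H^d_𝔞(M) ≠ 0. Then V(Ann_R(H^d_𝔞(M))) = Supp(M / T_R(𝔞, M)). -/

import Mathlib

open CategoryTheory

universe u

/-- `H^i_I(M) ≠ 0`: the `i`-th local cohomology of `M` with respect to `I` is nonzero. -/
abbrev LCNonzero {R : Type u} [CommRing R] (I : Ideal R) (i : ℕ)
    (M : Type u) [AddCommGroup M] [Module R M] : Prop :=
  Nontrivial ((localCohomology I i).obj (ModuleCat.of R M))

/-- Cohomological dimension `cd(I, M) = sup {i : H^i_I(M) ≠ 0}`, as an element of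
`WithBot ℕ∞` (it is `⊥` if all local cohomology of `M` vanishes). -/
noncomputable def cohDim {R : Type u} [CommRing R] (I : Ideal R)
    (M : Type u) [AddCommGroup M] [Module R M] : WithBot ℕ∞ :=
  sSup {n : WithBot ℕ∞ | ∃ i : ℕ, n = (i : ℕ∞) ∧ LCNonzero I i M}

/-- Krull dimension of a module, i.e. the Krull dimension of `R ⧸ Ann_R M`. -/
noncomputable def modDim (R : Type u) [CommRing R]
    (M : Type u) [AddCommGroup M] [Module R M] : WithBot ℕ∞ :=
  ringKrullDim (R ⧸ Module.annihilator R M)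

namespace LC
open CategoryTheory Limits Opposite
variable {R : Type u} [CommRing R]

noncomputable section

abbrev F (Y : ModuleCat.{u} R) : ModuleCat.{u} R ⥤ (ModuleCat.{u} R)ᵒᵖ :=
  ((linearYoneda R (ModuleCat.{u} R)).obj Y).rightOp

abbrev K {X : ModuleCat.{u} R} (P : ProjectiveResolution X) (Y : ModuleCat.{u} R) :
    ChainComplex (ModuleCat.{u} R)ᵒᵖ ℕ :=
  ((F Y).mapHomologicalComplex _).obj P.complex

abbrev E (n : ℕ) (X Y : ModuleCat.{u} R) : ModuleCat.{u} R :=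
  ((Ext R (ModuleCat.{u} R) n).obj (op X)).obj Y

/-- the element of the complex given by a map -/
def el {X : ModuleCat.{u} R} (P : ProjectiveResolution X) {Y : ModuleCat.{u} R} {n : ℕ}
    (f : P.complex.X n ⟶ Y) : ((K P Y).X n).unop := f

def isoE {X : ModuleCat.{u} R} (P : ProjectiveResolution X) (Y : ModuleCat.{u} R) (n : ℕ) :
   ((K P Y).homology n).unop ≅ E n X Y :=
  (P.isoLeftDerivedObj (F Y) n).unop

def Rep {X : ModuleCat.{u} R} (P : ProjectiveResolution X) {Y : ModuleCat.{u} R} {n : ℕ}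
    (f : P.complex.X n ⟶ Y) (e : E n X Y) : Prop :=
  ∃ z : ((K P Y).opcycles n).unop, ((K P Y).pOpcycles n).unop z = el P f ∧
    (isoE P Y n).hom (((K P Y).homologyι n).unop z) = e

variable {X : ModuleCat.{u} R} (P : ProjectiveResolution X) {Y : ModuleCat.{u} R} {n : ℕ}

lemma d_el {i j : ℕ} (f : P.complex.X j ⟶ Y) :
    ((K P Y).d i j).unop (el P f) = el P (P.complex.d i j ≫ f) := rfl

lemma rep_smul {f : P.complex.X n ⟶ Y} {e : E n X Y} (h : Rep P f e) (x : R) :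
    Rep P (x • f) (x • e) := by
  obtain ⟨z, h1, h2⟩ := h
  refine ⟨x • z, ?_, ?_⟩
  · rw [map_smul, h1]; rfl
  · simp [h2]

lemma exact_a : (ShortComplex.mk ((K P Y).d (n+1) n) ((K P Y).pOpcycles n)
    ((K P Y).d_pOpcycles (n+1) n)).Exact :=
  ShortComplex.exact_of_g_is_cokernel _ ((K P Y).opcyclesIsCokernel (n+1) n (by simp))

lemma exact_b : (ShortComplex.mk ((K P Y).homologyι n) 
    ((K P Y).fromOpcycles n ((ComplexShape.down ℕ).next n))
    ((K P Y).homologyι_comp_fromOpcycles n _)).Exact :=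
  ShortComplex.exact_of_f_is_kernel _ ((K P Y).homologyIsKernel n _ rfl)

lemma rep_exists {f : P.complex.X n ⟶ Y} (hf : P.complex.d (n+1) n ≫ f = 0) :
    ∃ e, Rep P f e := by
  have := (exact_a P (Y := Y) (n := n)).unop
  rw [ShortComplex.moduleCat_exact_iff] at this
  obtain ⟨z, hz⟩ := this (el P f) ((d_el P f).trans (by rw [hf]; rfl))
  exact ⟨_, z, hz, rfl⟩

lemma rep_surj (e : E n X Y) : ∃ f, P.complex.d (n+1) n ≫ f = 0 ∧ Rep P f e := by
  have hs : Function.Surjective ((K P Y).homologyι n).unop :=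
    (ModuleCat.epi_iff_surjective _).1 inferInstance
  obtain ⟨z, hz⟩ := hs ((isoE P Y n).inv e)
  refine ⟨((K P Y).pOpcycles n).unop z, ?_, z, rfl, ?_⟩
  · have : ((K P Y).pOpcycles n).unop ≫ ((K P Y).d (n+1) n).unop = 0 := by
      rw [← unop_comp, (K P Y).d_pOpcycles (n+1) n]; rfl
    exact ConcreteCategory.congr_hom this z
  · rw [hz]; simp

lemma rep_zero {f : P.complex.X n ⟶ Y} (h : Rep P f 0) :
    ∃ j g, f = P.complex.d n j ≫ g := by
  obtain ⟨z, h1, h2⟩ := h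
  have h3 : ((K P Y).homologyι n).unop z = 0 := by
    have := congrArg (isoE P Y n).inv h2
    simpa using this
  have := (exact_b P (Y := Y) (n := n)).unop
  rw [ShortComplex.moduleCat_exact_iff] at this
  obtain ⟨g, hg⟩ := this z h3
  refine ⟨_, g, ?_⟩
  change el P f = _
  rw [← h1, ← hg]
  have : ((K P Y).fromOpcycles n ((ComplexShape.down ℕ).next n)).unop ≫ ((K P Y).pOpcycles n).unop =
    ((K P Y).d n ((ComplexShape.down ℕ).next n)).unop := by
      rw [← unop_comp]; simp
  exact ConcreteCategory.congr_hom this g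

lemma rep_boundary {j : ℕ} {g : P.complex.X j ⟶ Y} {e : E n X Y}
    (h : Rep P (P.complex.d n j ≫ g) e) : e = 0 := by
  obtain ⟨z, h1, h2⟩ := h
  have hi : Function.Injective ((K P Y).pOpcycles n).unop :=
    (ModuleCat.mono_iff_injective _).1 inferInstance
  have : ((K P Y).fromOpcycles n j).unop ≫ ((K P Y).pOpcycles n).unop =
    ((K P Y).d n j).unop := by
      rw [← unop_comp]; simp
  have hz : z = ((K P Y).fromOpcycles n j).unop (el P g) := hi (by
    rw [h1, ← d_el]
    exact (ConcreteCategory.congr_hom this (el P g)).symm)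
  rw [← h2, hz]
  have : ((K P Y).fromOpcycles n j).unop ≫ ((K P Y).homologyι n).unop = 0 := by
      rw [← unop_comp]; simp
  have := ConcreteCategory.congr_hom this (el P g)
  erw [this]
  simp

lemma rep_mapY {Y' : ModuleCat.{u} R} (φ : Y ⟶ Y') {f : P.complex.X n ⟶ Y} {e : E n X Y}
    (h : Rep P f e) : Rep P (f ≫ φ) (((Ext R (ModuleCat.{u} R) n).obj (op X)).map φ e) := by
  obtain ⟨z, h1, h2⟩ := h
  let α : F Y' ⟶ F Y := NatTrans.rightOp ((linearYoneda R (ModuleCat.{u} R)).map φ)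
  let a : K P Y' ⟶ K P Y := (NatTrans.mapHomologicalComplex α _).app P.complex
  refine ⟨(HomologicalComplex.opcyclesMap a n).unop z, ?_, ?_⟩
  · have : (HomologicalComplex.opcyclesMap a n).unop ≫ ((K P Y').pOpcycles n).unop =
      ((K P Y).pOpcycles n).unop ≫ (a.f n).unop := by
      rw [← unop_comp, ← unop_comp]; simp
    refine (ConcreteCategory.congr_hom this z).trans ?_
    change (a.f n).unop (((K P Y).pOpcycles n).unop z) = _
    rw [h1]; rfl
  · have h3 := P.leftDerived_app_eq α n
    have h4 : (isoE P Y n).hom ≫ ((Ext R (ModuleCat.{u} R) n).obj (op X)).map φ =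
      (HomologicalComplex.homologyMap a n).unop ≫ (isoE P Y' n).hom := by
      change (P.isoLeftDerivedObj (F Y) n).hom.unop ≫ ((NatTrans.leftDerived α n).app X).unop = _
      rw [h3, ← unop_comp, Category.assoc, Category.assoc, Iso.inv_hom_id, Category.comp_id]
      rfl
    have h5 : (HomologicalComplex.opcyclesMap a n).unop ≫ ((K P Y').homologyι n).unop =
      ((K P Y).homologyι n).unop ≫ (HomologicalComplex.homologyMap a n).unop := by
      rw [← unop_comp, ← unop_comp]; simp
    rw [← h2]
    refine Eq.trans ?_ (ConcreteCategory.congr_hom h4 _).symm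
    exact congrArg (isoE P Y' n).hom (ConcreteCategory.congr_hom h5 z)

lemma rep_mapX {X' : ModuleCat.{u} R} (φ : X' ⟶ X) (P' : ProjectiveResolution X')
    (ψ : P'.complex ⟶ P.complex) (comm : ψ.f 0 ≫ P.π.f 0 = P'.π.f 0 ≫ φ)
    {f : P.complex.X n ⟶ Y} {e : E n X Y}
    (h : Rep P f e) : Rep P' (ψ.f n ≫ f) (((Ext R (ModuleCat.{u} R) n).map φ.op).app Y e) := by
  obtain ⟨z, h1, h2⟩ := h
  let a : K P' Y ⟶ K P Y := ((F Y).mapHomologicalComplex _).map ψ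
  refine ⟨(HomologicalComplex.opcyclesMap a n).unop z, ?_, ?_⟩
  · have : (HomologicalComplex.opcyclesMap a n).unop ≫ ((K P' Y).pOpcycles n).unop =
      ((K P Y).pOpcycles n).unop ≫ (a.f n).unop := by
      rw [← unop_comp, ← unop_comp, HomologicalComplex.p_opcyclesMap]
    refine (ConcreteCategory.congr_hom this z).trans ?_
    change (a.f n).unop (((K P Y).pOpcycles n).unop z) = _
    rw [h1]; rfl
  · have h3 := P'.isoLeftDerivedObj_hom_naturality φ P ψ comm (F Y) n
    have h4 : (isoE P Y n).hom ≫ ((Ext R (ModuleCat.{u} R) n).map φ.op).app Y =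
      (HomologicalComplex.homologyMap a n).unop ≫ (isoE P' Y n).hom := by
      exact congrArg Quiver.Hom.unop h3
    have h5 : (HomologicalComplex.opcyclesMap a n).unop ≫ ((K P' Y).homologyι n).unop =
      ((K P Y).homologyι n).unop ≫ (HomologicalComplex.homologyMap a n).unop := by
      rw [← unop_comp, ← unop_comp, HomologicalComplex.homologyι_naturality]
    rw [← h2]
    refine Eq.trans ?_ (ConcreteCategory.congr_hom h4 _).symm
    exact congrArg (isoE P' Y n).hom (ConcreteCategory.congr_hom h5 z)

section loc
variable (a : Ideal R)

abbrev Q (t : ℕ) : ModuleCat.{u} R := ModuleCat.of R (R ⧸ a ^ t)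

def Pt (t : ℕ) : ProjectiveResolution (Q a t) := projectiveResolution _

abbrev D := localCohomology.diagram (localCohomology.idealPowersDiagram a)

abbrev H (i : ℕ) (Y : ModuleCat.{u} R) : ModuleCat.{u} R := (localCohomology a i).obj Y

def iota (i : ℕ) (Y : ModuleCat.{u} R) (t : ℕ) : E i (Q a t) Y ⟶ H a i Y :=
  (colimit.ι (D a i) (op (op t))).app Y

def isCol (i : ℕ) (Y : ModuleCat.{u} R) :=
  isColimitOfPreserves ((evaluation _ _).obj Y) (colimit.isColimit (D a i))

instance pres : PreservesFilteredColimitsOfSize.{0, 0} (forget (ModuleCat.{u} R)) :=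
  preservesSmallestFilteredColimits_of_preservesFilteredColimits _

instance presi (i : ℕ) (Y : ModuleCat.{u} R) :
    PreservesColimit (D a i ⋙ (evaluation (ModuleCat R) (ModuleCat R)).obj Y)
      (forget (ModuleCat R)) :=
  have := (pres (R := R)).preserves_filtered_colimits (ℕᵒᵖᵒᵖ)
  inferInstance

def tr {s t : ℕ} (h : t ≤ s) : Q a s ⟶ Q a t :=
  (localCohomology.ringModIdeals (localCohomology.idealPowersDiagram a)).map (homOfLE h).op

lemma iota_tr {i : ℕ} {Y : ModuleCat.{u} R} {s t : ℕ} (h : t ≤ s) (e : E i (Q a t) Y) :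
    iota a i Y s (((Ext R (ModuleCat.{u} R) i).map (tr a h).op).app Y e) = iota a i Y t e := by
  have := congrArg (fun q => q.app Y) (colimit.w (D a i) ((homOfLE h).op.op))
  exact ConcreteCategory.congr_hom this e

lemma iota_surj {i : ℕ} {Y : ModuleCat.{u} R} (h : H a i Y) : ∃ t e, iota a i Y t e = h := by
  obtain ⟨j, x, hx⟩ := Concrete.isColimit_exists_rep _ (isCol a i Y) h
  exact ⟨j.unop.unop, x, hx⟩

lemma iota_zero {i : ℕ} {Y : ModuleCat.{u} R} {t : ℕ} (e : E i (Q a t) Y)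
    (he : iota a i Y t e = 0) : ∃ s, ∃ h : t ≤ s,
      ((Ext R (ModuleCat.{u} R) i).map (tr a h).op).app Y e = 0 := by
  have h0 : iota a i Y t e = iota a i Y t 0 := by rw [he]; simp
  obtain ⟨k, f, g, hfg⟩ := Concrete.isColimit_exists_of_rep_eq.{u} _ (isCol a i Y)
    (i := op (op t)) (j := op (op t)) e 0 h0
  refine ⟨k.unop.unop, leOfHom f.unop.unop, ?_⟩
  refine Eq.trans hfg ?_
  exact map_zero _

lemma iota_mapY {i : ℕ} {Y Y' : ModuleCat.{u} R} (φ : Y ⟶ Y') {t : ℕ} (e : E i (Q a t) Y) :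
    (localCohomology a i).map φ (iota a i Y t e) =
      iota a i Y' t (((Ext R (ModuleCat.{u} R) i).obj (op _)).map φ e) := by
  have := (colimit.ι (D a i) (op (op t))).naturality φ
  exact (ConcreteCategory.congr_hom this e).symm

def li {s t : ℕ} (h : t ≤ s) : (Pt a s).complex ⟶ (Pt a t).complex :=
  ProjectiveResolution.lift (tr a h) _ _

lemma li_comm {s t : ℕ} (h : t ≤ s) :
    (li a h).f 0 ≫ (Pt a t).π.f 0 = (Pt a s).π.f 0 ≫ tr a h := by
  exact ProjectiveResolution.lift_commutes_zero _ _ _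

def RepH {i : ℕ} {Y : ModuleCat.{u} R} (t : ℕ) (f : (Pt a t).complex.X i ⟶ Y) (h : H a i Y) : Prop :=
  ∃ e, Rep (Pt a t) f e ∧ iota a i Y t e = h

variable {i : ℕ} {Y Y' : ModuleCat.{u} R}

lemma H1 (h : H a i Y) : ∃ t f, (Pt a t).complex.d (i+1) i ≫ f = 0 ∧ RepH a t f h := by
  obtain ⟨t, e, rfl⟩ := iota_surj a h
  obtain ⟨f, h1, h2⟩ := rep_surj (Pt a t) e
  exact ⟨t, f, h1, e, h2, rfl⟩

variable {a}
lemma H3 {t s : ℕ} (hs : t ≤ s) {f : (Pt a t).complex.X i ⟶ Y} {h : H a i Y} (hf : RepH a t f h) :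
    RepH a s ((li a hs).f i ≫ f) h := by
  obtain ⟨e, he, rfl⟩ := hf
  exact ⟨_, rep_mapX _ (tr a hs) _ _ (li_comm a hs) he, iota_tr a hs e⟩

lemma H2 {t : ℕ} {f : (Pt a t).complex.X i ⟶ Y} (hf : RepH a t f 0) :
    ∃ s, ∃ h : t ≤ s, ∃ j g, (li a h).f i ≫ f = (Pt a s).complex.d i j ≫ g := by
  obtain ⟨e, he, h0⟩ := hf
  obtain ⟨s, hs, h⟩ := iota_zero a e h0
  have := rep_mapX _ (tr a hs) _ _ (li_comm a hs) he
  rw [h] at this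
  exact ⟨s, hs, rep_zero _ this⟩

lemma H4 {t j : ℕ} {g : (Pt a t).complex.X j ⟶ Y} {h : H a i Y}
    (hf : RepH a t ((Pt a t).complex.d i j ≫ g) h) : h = 0 := by
  obtain ⟨e, he, rfl⟩ := hf
  rw [rep_boundary _ he, map_zero]

lemma H5 (φ : Y ⟶ Y') {t : ℕ} {f : (Pt a t).complex.X i ⟶ Y} {h : H a i Y} (hf : RepH a t f h) :
    RepH a t (f ≫ φ) ((localCohomology a i).map φ h) := by
  obtain ⟨e, he, rfl⟩ := hf
  exact ⟨_, rep_mapY _ φ he, (iota_mapY a φ e).symm⟩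

lemma H6 {t : ℕ} {f : (Pt a t).complex.X i ⟶ Y} (hf : (Pt a t).complex.d (i+1) i ≫ f = 0) :
    ∃ h, RepH a t f h := by
  obtain ⟨e, he⟩ := rep_exists _ hf
  exact ⟨_, e, he, rfl⟩

lemma H7 (x : R) {t : ℕ} {f : (Pt a t).complex.X i ⟶ Y} {h : H a i Y} (hf : RepH a t f h) :
    RepH a t (x • f) (x • h) := by
  obtain ⟨e, he, rfl⟩ := hf
  exact ⟨_, rep_smul _ he x, by simp⟩

lemma rep_sub {X : ModuleCat.{u} R} (P : ProjectiveResolution X) {n : ℕ}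
    {f f' : P.complex.X n ⟶ Y} {e e' : E n X Y} (h : Rep P f e) (h' : Rep P f' e') :
    Rep P (f - f') (e - e') := by
  obtain ⟨z, h1, h2⟩ := h
  obtain ⟨z', h1', h2'⟩ := h'
  refine ⟨z - z', ?_, ?_⟩
  · rw [map_sub, h1, h1']; rfl
  · simp [h2, h2']

lemma RepH_sub {t : ℕ} {f f' : (Pt a t).complex.X i ⟶ Y} {h h' : H a i Y} (hf : RepH a t f h)
    (hf' : RepH a t f' h') :
    RepH a t (f - f') (h - h') := by
  obtain ⟨e, he, rfl⟩ := hf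
  obtain ⟨e', he', rfl⟩ := hf'
  exact ⟨_, rep_sub _ he he', by simp⟩

lemma H0 {t : ℕ} {h : H a i Y} (hf : RepH a t (0 : (Pt a t).complex.X i ⟶ Y) h) : h = 0 :=
  H4 (j := 0) (g := 0) (by simpa using hf)

lemma H9 {t : ℕ} {f : (Pt a t).complex.X i ⟶ Y} {h h' : H a i Y} (hf : RepH a t f h)
    (hf' : RepH a t f h') : h = h' := by
  have := RepH_sub hf hf'
  rw [sub_self] at this
  exact sub_eq_zero.1 (H0 this)

lemma H8 {x : R} {t : ℕ} (hx : x ∈ a ^ t) {f : (Pt a t).complex.X i ⟶ Y} {h : H a i Y}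
    (hf : RepH a t f h) : x • h = 0 := by
  obtain ⟨e, he, rfl⟩ := hf
  have hz : x • 𝟙 (Q a t) = 0 := by
    refine ModuleCat.hom_ext (LinearMap.ext fun y => ?_)
    obtain ⟨y, rfl⟩ := Ideal.Quotient.mk_surjective y
    change x • (Ideal.Quotient.mk (a ^ t) y) = 0
    rw [← Ideal.Quotient.mk_eq_mk, ← Submodule.Quotient.mk_smul, Submodule.Quotient.mk_eq_zero]
    exact Ideal.mul_mem_right _ _ hx
  have h1 := rep_mapX _ (0 : Q a t ⟶ Q a t) (Pt a t) 0
    (zero_comp.trans comp_zero.symm) he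
  have h2 := rep_mapX _ (x • 𝟙 (Q a t)) (Pt a t) (x • 𝟙 _) (by
      have h5 : (x • 𝟙 ((Pt a t).complex.X 0)) ≫ (Pt a t).π.f 0 = x • (Pt a t).π.f 0 := by
        rw [Linear.smul_comp, Category.id_comp]
      exact h5.trans ((Linear.comp_smul _ _ _ (f := (Pt a t).π.f 0) (r := x) (g := 𝟙 (Q a t))).trans
        (congrArg (x • ·) (Category.comp_id _))).symm) he
  rw [hz] at h2
  have h3 : RepH a t (x • f) (0 : H a i Y) := by
    refine ⟨0, ?_, map_zero _⟩
    simpa using rep_sub _ h2 h1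
  exact H9 (H7 x ⟨e, he, rfl⟩) h3

lemma map_smul_id (x : R) (φ : Y ⟶ Y') (h : H a i Y) :
    (localCohomology a i).map (x • φ) h = x • (localCohomology a i).map φ h := by
  obtain ⟨t, f, -, hf⟩ := H1 a h
  have := H5 (x • φ) hf
  rw [Linear.comp_smul] at this
  exact H9 this (H7 x (H5 φ hf))

variable {S : ShortComplex (ModuleCat.{u} R)}

lemma liftB (hS : S.ShortExact) {t n : ℕ} (k : (Pt a t).complex.X n ⟶ S.X₃) :
    ∃ k', k' ≫ S.g = k := by
  have := hS.epi_g
  have : Projective ((Pt a t).complex.X n) := (Pt a t).projective n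
  exact ⟨Projective.factorThru k S.g, Projective.factorThru_comp _ _⟩

lemma liftA (hS : S.ShortExact) {Z : ModuleCat.{u} R} (k : Z ⟶ S.X₂) (hk : k ≫ S.g = 0) :
    ∃ k', k' ≫ S.f = k := by
  have := hS.mono_f
  exact ⟨hS.exact.lift k hk, hS.exact.lift_f k hk⟩

lemma mid (hS : S.ShortExact) (h1 : ∀ h : H a i S.X₁, h = 0) (h3 : ∀ h : H a i S.X₃, h = 0)
    (h : H a i S.X₂) : h = 0 := by
  have := hS.mono_f
  obtain ⟨t, f, hf0, hf⟩ := H1 a h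
  have e1 := H5 S.g hf
  rw [h3 ((localCohomology a i).map S.g h)] at e1
  obtain ⟨s, hs, j, k, hk⟩ := H2 e1
  obtain ⟨k', rfl⟩ := liftB hS k
  obtain ⟨m, hm⟩ := liftA hS ((li a hs).f i ≫ f - (Pt a s).complex.d i j ≫ k') (by
    rw [Preadditive.sub_comp, Category.assoc, Category.assoc, hk, sub_self])
  have hm0 : (Pt a s).complex.d (i+1) i ≫ m = 0 := by
    rw [← cancel_mono S.f, Category.assoc, hm, Preadditive.comp_sub, ← Category.assoc,
      ← HomologicalComplex.Hom.comm, Category.assoc, hf0]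
    simp
  obtain ⟨h', hh'⟩ := H6 hm0
  rw [h1 h'] at hh'
  have e2 := RepH_sub (H3 hs hf) (H5 S.f hh')
  rw [hm, sub_sub_cancel] at e2
  simpa using H4 e2

lemma sur (hS : S.ShortExact) (h1 : ∀ h : H a (i+1) S.X₁, h = 0) (h : H a i S.X₃) :
    ∃ h', (localCohomology a i).map S.g h' = h := by
  have := hS.mono_f
  obtain ⟨t, f, hf0, hf⟩ := H1 a h
  obtain ⟨f', rfl⟩ := liftB hS f
  obtain ⟨m, hm⟩ := liftA hS ((Pt a t).complex.d (i+1) i ≫ f') (by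
    rw [Category.assoc, hf0])
  obtain ⟨h', hh'⟩ := H6 (a := a) (i := i+1) (f := m) (by
    rw [← cancel_mono S.f, Category.assoc, hm]; simp)
  rw [h1 h'] at hh'
  obtain ⟨s, hs, k, hk⟩ : ∃ s, ∃ hs : t ≤ s, ∃ k : (Pt a s).complex.X i ⟶ S.X₁,
      (li a hs).f (i+1) ≫ m = (Pt a s).complex.d (i+1) i ≫ k := by
    obtain ⟨s, hs, j, k, hk⟩ := H2 hh'
    by_cases hj : j = i
    · subst hj; exact ⟨s, hs, k, hk⟩
    · refine ⟨s, hs, 0, ?_⟩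
      rw [hk, HomologicalComplex.shape _ _ _ (by simpa using hj)]
      simp
  obtain ⟨h2, hh2⟩ := H6 (a := a) (i := i) (t := s) (f := (li a hs).f i ≫ f' - k ≫ S.f) (by
    rw [Preadditive.comp_sub, ← Category.assoc, ← HomologicalComplex.Hom.comm, Category.assoc,
      ← hm, ← Category.assoc, hk]; simp)
  refine ⟨h2, ?_⟩
  have e1 := H5 S.g hh2
  rw [Preadditive.sub_comp, Category.assoc, Category.assoc, S.zero, comp_zero, sub_zero] at e1
  exact H9 e1 (H3 hs hf)

lemma inj (hS : S.ShortExact)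
    (h3 : ∀ h : H a i S.X₃, ∃ h', (localCohomology a i).map S.g h' = h)
    (h : H a (i+1) S.X₁) (hh : (localCohomology a (i+1)).map S.f h = 0) : h = 0 := by
  have := hS.mono_f
  obtain ⟨t, f, hf0, hf⟩ := H1 a h
  have e1 := H5 S.f hf
  rw [hh] at e1
  obtain ⟨s, hs, k, hk⟩ : ∃ s, ∃ hs : t ≤ s, ∃ k : (Pt a s).complex.X i ⟶ S.X₂,
      (li a hs).f (i+1) ≫ f ≫ S.f = (Pt a s).complex.d (i+1) i ≫ k := by
    obtain ⟨s, hs, j, k, hk⟩ := H2 e1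
    by_cases hj : j = i
    · subst hj; exact ⟨s, hs, k, hk⟩
    · refine ⟨s, hs, 0, ?_⟩
      rw [hk, HomologicalComplex.shape _ _ _ (by simpa using hj)]
      simp
  replace hf := H3 hs hf
  rw [← Category.assoc] at hk
  generalize (li a hs).f (i+1) ≫ f = f at hf hk
  obtain ⟨h3', hh3⟩ := H6 (a := a) (i := i) (t := s) (f := k ≫ S.g) (by
    rw [← Category.assoc, ← hk]; simp)
  obtain ⟨h2, rfl⟩ := h3 h3'
  obtain ⟨s', m, hm0, hm⟩ := H1 a h2
  have e2 := H3 (le_max_left s s') hh3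
  have e3 := H3 (le_max_right s s') (H5 S.g hm)
  have e4 := RepH_sub e2 e3
  rw [sub_self] at e4
  obtain ⟨r, hr, j, q, hq⟩ := H2 e4
  obtain ⟨q, rfl⟩ := liftB hS q
  set l1 := (li a (le_max_left s s')) with hl1
  set l2 := (li a (le_max_right s s')) with hl2
  set l3 := li a hr with hl3
  obtain ⟨p, hp⟩ := liftA hS (l3.f i ≫ l1.f i ≫ k - l3.f i ≫ l2.f i ≫ m -
      (Pt a r).complex.d i j ≫ q) (by
    simp only [Preadditive.sub_comp, Category.assoc, Preadditive.comp_sub] at hq ⊢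
    rw [hq, sub_self])
  have e5 := H3 hr (H3 (le_max_left s s') hf)
  have e6 : l3.f (i+1) ≫ l1.f (i+1) ≫ f = (Pt a r).complex.d (i+1) i ≫ p := by
    rw [← cancel_mono S.f]
    simp only [Category.assoc]
    rw [hp, hk]
    simp only [Preadditive.comp_sub, HomologicalComplex.Hom.comm_assoc,
      HomologicalComplex.d_comp_d_assoc, zero_comp, comp_zero, sub_zero]
    simp only [← HomologicalComplex.Hom.comm_assoc, hm0, comp_zero, sub_zero]
  rw [← hl1, ← hl3, e6] at e5
  exact H4 e5

variable (a) in
def Tors (Y : Type u) [AddCommGroup Y] [Module R Y] : Prop :=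
  ∀ y : Y, ∃ k, ∀ x ∈ a ^ k, x • y = 0

variable (a) in
def Gam (Y : Type u) [AddCommGroup Y] [Module R Y] : Submodule R Y where
  carrier := {y | ∃ k, ∀ x ∈ a ^ k, x • y = 0}
  zero_mem' := ⟨0, by simp⟩
  add_mem' := by
    rintro y z ⟨k, hk⟩ ⟨l, hl⟩
    refine ⟨max k l, fun x hx => ?_⟩
    rw [smul_add, hk x (Ideal.pow_le_pow_right (le_max_left k l) hx),
      hl x (Ideal.pow_le_pow_right (le_max_right k l) hx), add_zero]
  smul_mem' := by
    rintro c y ⟨k, hk⟩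
    exact ⟨k, fun x hx => by rw [smul_comm, hk x hx, smul_zero]⟩

lemma tors_gam (Y : Type u) [AddCommGroup Y] [Module R Y] : Tors a (Gam a Y) := by
  rintro ⟨y, k, hk⟩
  exact ⟨k, fun x hx => Subtype.ext (hk x hx)⟩

lemma tors_fg {Y Z : Type u} [AddCommGroup Y] [Module R Y] [AddCommGroup Z] [Module R Z]
    [Module.Finite R Z] (hY : Tors a Y) (g : Z →ₗ[R] Y) : ∃ k, ∀ x ∈ a ^ k, ∀ z, x • g z = 0 := by
  obtain ⟨s, hs⟩ := Module.Finite.fg_top (R := R) (M := Z)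
  choose k hk using hY
  refine ⟨s.sup (fun z => k (g z)), fun x hx z => ?_⟩
  have hz : z ∈ Submodule.span R (s : Set Z) := by rw [hs]; trivial
  induction hz using Submodule.span_induction with
  | mem z hz =>
    exact hk _ x (Ideal.pow_le_pow_right (Finset.le_sup (f := fun z => k (g z)) hz) hx)
  | zero => simp
  | add y z _ _ h1 h2 => rw [map_add, smul_add, h1, h2, add_zero]
  | smul c y _ h => rw [map_smul, smul_comm, h, smul_zero]

lemma inj_gam [IsNoetherianRing R] (Y : Type u) [AddCommGroup Y] [Module R Y] [Module.Injective R Y] :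
    Module.Injective R (Gam a Y) := by
  refine Module.Baer.injective ?_
  intro J g
  obtain ⟨k, hk⟩ := tors_fg (tors_gam (a := a) Y) g
  obtain ⟨k0, hk0⟩ := Ideal.exists_pow_inf_eq_pow_smul a (J : Submodule R R)
  let n := k0 + k
  let φ : J →ₗ[R] (R ⧸ a ^ n) := (Submodule.mkQ (a ^ n)).comp J.subtype
  have hker : LinearMap.ker φ ≤ LinearMap.ker ((Gam a Y).subtype.comp g) := by
    rintro ⟨y, hy⟩ hy'
    have hy1 : y ∈ a ^ n := by
      simpa [φ, Submodule.Quotient.mk_eq_zero, Ideal.Quotient.eq_zero_iff_mem] using hy'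
    have hy2 : y ∈ a ^ k • (J : Submodule R R) := by
      have h1 : y ∈ a ^ n • ⊤ ⊓ (J : Submodule R R) := ⟨by simpa using hy1, hy⟩
      rw [hk0 n (Nat.le_add_right _ _)] at h1
      have : n - k0 = k := by simp [n]
      rw [this] at h1
      exact Submodule.smul_mono le_rfl inf_le_right h1
    have hy3 : ∃ h : y ∈ J, g ⟨y, h⟩ = 0 := by
      refine Submodule.smul_induction_on hy2 ?_ ?_
      · intro r hr z hz
        refine ⟨J.smul_mem r hz, ?_⟩
        have := hk r hr ⟨z, hz⟩
        rw [← map_smul] at this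
        exact this
      · rintro x y ⟨hx, h1⟩ ⟨hy, h2⟩
        refine ⟨J.add_mem hx hy, ?_⟩
        have := map_add g ⟨x, hx⟩ ⟨y, hy⟩
        rw [h1, h2, add_zero] at this
        exact this
    obtain ⟨_, h⟩ := hy3
    simp [h]
  obtain ⟨e, he⟩ := Module.Injective.out (R := R) (Q := Y) ((LinearMap.ker φ).liftQ φ le_rfl)
    (LinearMap.ker_eq_bot.1 (Submodule.ker_liftQ_eq_bot _ _ _ le_rfl))
    ((LinearMap.ker φ).liftQ ((Gam a Y).subtype.comp g) hker)
  have he1 : e (Submodule.Quotient.mk 1) ∈ Gam a Y := by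
    refine ⟨n, fun x hx => ?_⟩
    rw [← map_smul, ← Submodule.Quotient.mk_smul, (Submodule.Quotient.mk_eq_zero _).2, map_zero]
    simpa using hx
  refine ⟨LinearMap.toSpanSingleton R _ ⟨_, he1⟩, fun x hx => ?_⟩
  have := he (Submodule.Quotient.mk ⟨x, hx⟩)
  rw [Submodule.liftQ_apply, Submodule.liftQ_apply] at this
  refine Subtype.ext ?_
  refine Eq.trans ?_ this
  change x • e _ = e (Submodule.Quotient.mk x)
  rw [← map_smul, ← Submodule.Quotient.mk_smul]
  simp

lemma H_inj [Injective Y] (h : H a (i+1) Y) : h = 0 := by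
  obtain ⟨t, f, hf0, hf⟩ := H1 a h
  have hx := (Pt a t).exact_succ i
  have : f = (Pt a t).complex.d (i+1) i ≫ hx.descToInjective f hf0 :=
    (hx.comp_descToInjective f hf0).symm
  rw [this] at hf
  exact H4 hf

lemma sur0 (hS : S.ShortExact) (ht : Tors a S.X₂) (h : H a 0 S.X₃) :
    ∃ h', (localCohomology a 0).map S.g h' = h := by
  obtain ⟨t, f, hf0, hf⟩ := H1 a h
  have hsg := (ModuleCat.epi_iff_surjective _).1 hS.epi_g
  let c : Q a t ⟶ S.X₃ := (Pt a t).exact₀.desc f hf0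
  have hc : (Pt a t).π.f 0 ≫ c = f := (Pt a t).exact₀.g_desc f hf0
  obtain ⟨b, hb⟩ := hsg (c (Submodule.Quotient.mk 1))
  obtain ⟨k, hk⟩ := ht b
  let s := max t k
  have hs : t ≤ s := le_max_left _ _
  let β : Q a s ⟶ S.X₂ := ModuleCat.ofHom ((a ^ s).liftQ (LinearMap.toSpanSingleton R _ b) (by
    intro x hx
    simpa using hk x (Ideal.pow_le_pow_right (le_max_right _ _) hx)))
  have hβ : β ≫ S.g = tr a hs ≫ c := by
    refine ModuleCat.hom_ext (LinearMap.ext fun y => ?_)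
    obtain ⟨y, rfl⟩ := Submodule.Quotient.mk_surjective _ y
    change S.g (y • b) = c (Submodule.Quotient.mk y)
    rw [map_smul, hb, ← map_smul, ← Submodule.Quotient.mk_smul]
    simp
  obtain ⟨h2, hh2⟩ := H6 (a := a) (i := 0) (t := s) (f := (Pt a s).π.f 0 ≫ β) (by
    have := (Pt a s).complex_d_comp_π_f_zero
    exact ((Category.assoc _ _ _).symm.trans (congrArg (· ≫ β) this)).trans zero_comp)
  refine ⟨h2, H9 (H5 S.g hh2) ?_⟩
  have e : ((Pt a s).π.f 0 ≫ β) ≫ S.g = (li a hs).f 0 ≫ f := by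
    rw [← hc]
    refine (Category.assoc _ _ _).trans ?_
    refine (congrArg ((Pt a s).π.f 0 ≫ ·) hβ).trans ?_
    refine (Category.assoc _ _ _).symm.trans ?_
    have := congrArg (· ≫ c) (li_comm a hs).symm
    exact this.trans (Category.assoc _ _ _)
  rw [e]
  exact H3 hs hf

lemma se {A B C : Type u} [AddCommGroup A] [Module R A] [AddCommGroup B] [Module R B]
    [AddCommGroup C] [Module R C] (f : A →ₗ[R] B) (g : B →ₗ[R] C) (hf : Function.Injective f)
    (hg : Function.Surjective g) (hfg : Function.Exact f g) :
    (ShortComplex.mk (ModuleCat.ofHom f) (ModuleCat.ofHom g)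
      (ModuleCat.hom_ext hfg.linearMap_comp_eq_zero)).ShortExact where
  exact := by
    rw [ShortComplex.moduleCat_exact_iff]
    intro x hx
    exact (hfg x).1 hx
  mono_f := (ModuleCat.mono_iff_injective _).2 hf
  epi_g := (ModuleCat.epi_iff_surjective _).2 hg

theorem tors_van [IsNoetherianRing R] (i : ℕ) (Y : Type u) [AddCommGroup Y] [Module R Y]
    (hY : Tors a Y) (h : H a (i+1) (ModuleCat.of R Y)) : h = 0 := by
  induction i generalizing Y with
  | zero | succ i ih =>
    all_goals
    let I := Injective.under (ModuleCat.of R Y)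
    have : Injective (ModuleCat.of R I) := inferInstanceAs (Injective (Injective.under _))
    have : Module.Injective R I := Module.injective_module_of_injective_object R I
    have : Module.Injective R (Gam a I) := inj_gam (a := a) I
    have hG : Injective (ModuleCat.of R (Gam a I)) := Module.injective_object_of_injective_module R _
    let f0 : Y →ₗ[R] I := (Injective.ι (ModuleCat.of R Y)).hom
    have hf0 : Function.Injective f0 := (ModuleCat.mono_iff_injective _).1 (Injective.ι_mono _)
    let f : Y →ₗ[R] Gam a I := f0.codRestrict (Gam a I) (fun y => by
      obtain ⟨k, hk⟩ := hY y
      exact ⟨k, fun x hx => by rw [← map_smul, hk x hx, map_zero]⟩)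
    have hS := se f (LinearMap.range f).mkQ (fun x y hxy => hf0 (congrArg Subtype.val hxy))
      (Submodule.mkQ_surjective _) (LinearMap.exact_map_mkQ_range f)
    refine inj hS ?_ h (H_inj _)
    first
    | exact sur0 hS (tors_gam _)
    | intro h'
      refine ⟨0, ?_⟩
      rw [map_zero]
      refine (ih _ ?_ h').symm
      intro y
      obtain ⟨y, rfl⟩ := Submodule.mkQ_surjective _ y
      obtain ⟨k, hk⟩ := tors_gam (a := a) I y
      exact ⟨k, fun x hx => by rw [← map_smul, hk x hx, map_zero]⟩

lemma sur2 (hS : S.ShortExact) (h3 : ∀ h : H a i S.X₃, h = 0) (h : H a i S.X₂) :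
    ∃ h', (localCohomology a i).map S.f h' = h := by
  have := hS.mono_f
  obtain ⟨t, f, hf0, hf⟩ := H1 a h
  have e1 := H5 S.g hf
  rw [h3 ((localCohomology a i).map S.g h)] at e1
  obtain ⟨s, hs, j, k, hk⟩ := H2 e1
  obtain ⟨k, rfl⟩ := liftB hS k
  obtain ⟨m, hm⟩ := liftA hS ((li a hs).f i ≫ f - (Pt a s).complex.d i j ≫ k) (by
    rw [Preadditive.sub_comp, Category.assoc, Category.assoc, hk, sub_self])
  have hm0 : (Pt a s).complex.d (i+1) i ≫ m = 0 := by
    rw [← cancel_mono S.f, Category.assoc, hm, Preadditive.comp_sub, ← Category.assoc,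
      ← HomologicalComplex.Hom.comm, Category.assoc, hf0]
    simp
  obtain ⟨h', hh'⟩ := H6 hm0
  refine ⟨h', ?_⟩
  have e2 := RepH_sub (H3 hs hf) (H5 S.f hh')
  rw [hm, sub_sub_cancel] at e2
  exact (sub_eq_zero.1 (H4 e2)).symm

variable (a) in
def Van (i : ℕ) (Y : Type u) [AddCommGroup Y] [Module R Y] : Prop :=
  ∀ h : H a i (ModuleCat.of R Y), h = 0

lemma van_sub (i : ℕ) (Y : Type u) [AddCommGroup Y] [Module R Y] [Subsingleton Y] : Van a i Y := by
  intro h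
  obtain ⟨t, f, hf0, hf⟩ := H1 a h
  have : f = 0 := ModuleCat.hom_ext (LinearMap.ext fun y => Subsingleton.elim (α := Y) _ _)
  rw [this] at hf
  exact H0 hf

lemma not_van (i : ℕ) (Y : Type u) [AddCommGroup Y] [Module R Y] :
    LCNonzero a i Y ↔ ¬ Van a i Y := by
  rw [LCNonzero, ← not_subsingleton_iff_nontrivial, not_iff_not]
  exact ⟨fun _ h => Subsingleton.elim _ _, fun h => ⟨fun x y => (h x).trans (h y).symm⟩⟩

section lin
variable {A B C : Type u} [AddCommGroup A] [Module R A] [AddCommGroup B] [Module R B]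
    [AddCommGroup C] [Module R C] {f : A →ₗ[R] B} {g : B →ₗ[R] C}

lemma van_mid (hf : Function.Injective f)
    (hg : Function.Surjective g) (hfg : Function.Exact f g) (h1 : Van a i A) (h3 : Van a i C) :
    Van a i B :=
  fun h => mid (se f g hf hg hfg) h1 h3 h

lemma van_equiv (e : A ≃ₗ[R] B) (h : Van a i B) : Van a i A := by
  refine van_mid (f := (0 : PUnit.{u+1} →ₗ[R] A)) (g := e.toLinearMap)
    (Function.injective_of_subsingleton _) e.surjective ?_ (van_sub _ _) h
  intro y
  constructor
  · intro hy
    exact ⟨0, (e.map_eq_zero_iff.1 hy).symm⟩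
  · rintro ⟨_, rfl⟩
    simp

end lin

lemma quot_dim (p : Ideal R) [p.IsPrime] (L : Submodule R (R ⧸ p)) (hL : L ≠ ⊥) :
    Module.supportDim R ((R ⧸ p) ⧸ L) + 1 ≤ Module.supportDim R (R ⧸ p) := by
  obtain ⟨y, hy, hy0⟩ := (Submodule.ne_bot_iff _).1 hL
  obtain ⟨x, rfl⟩ := Ideal.Quotient.mk_surjective y
  have hx : x ∈ Module.annihilator R ((R ⧸ p) ⧸ L) := by
    rw [Module.mem_annihilator]
    intro m
    obtain ⟨m, rfl⟩ := Submodule.mkQ_surjective _ m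
    obtain ⟨m, rfl⟩ := Ideal.Quotient.mk_surjective m
    rw [← map_smul, Submodule.mkQ_apply, Submodule.Quotient.mk_eq_zero]
    have : x • Ideal.Quotient.mk p m = m • Ideal.Quotient.mk p x := by
      simp only [Algebra.smul_def, Ideal.Quotient.algebraMap_eq, mul_comm]
    rw [this]
    exact L.smul_mem _ hy
  have hp : p ≤ Module.annihilator R ((R ⧸ p) ⧸ L) := by
    have := LinearMap.annihilator_le_of_surjective L.mkQ (Submodule.mkQ_surjective _)
    rwa [Ideal.annihilator_quotient] at this
  rw [Module.supportDim_eq_ringKrullDim_quotient_annihilator,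
    Module.supportDim_quotient_eq_ringKrullDim]
  refine ringKrullDim_succ_le_of_surjective (Ideal.Quotient.factor hp)
    (Ideal.Quotient.factor_surjective hp) (r := Ideal.Quotient.mk p x)
    (mem_nonZeroDivisors_of_ne_zero hy0) ?_
  rw [Ideal.Quotient.factor_mk]
  exact Ideal.Quotient.eq_zero_iff_mem.2 hx

lemma dim_aux {b c : WithBot ℕ∞} {n : ℕ} (h : b + 1 ≤ c) (hc : c < ((n + 1 : ℕ) : WithBot ℕ∞)) :
    b < (n : WithBot ℕ∞) := by
  by_contra! h'
  have : (n : WithBot ℕ∞) + 1 ≤ b + 1 := by gcongr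
  push_cast at hc
  exact absurd hc (not_lt.2 (this.trans h))

lemma pow_kill {x : R} (hx : x ∈ a) (h : H a i Y) : ∃ k : ℕ, x ^ k • h = 0 := by
  obtain ⟨t, f, hf0, hf⟩ := H1 a h
  exact ⟨t, H8 (Ideal.pow_mem_pow hx t) hf⟩

theorem van_lt [IsNoetherianRing R] (n : ℕ) (L : Type u) [AddCommGroup L] [Module R L]
    [hfin : Module.Finite R L] (h : Module.supportDim R L < (n : WithBot ℕ∞)) (i : ℕ) (hi : n ≤ i) :
    Van a i L := by
  induction n generalizing L i with
  | zero =>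
    have : Subsingleton L := by
      by_contra hL
      rw [not_subsingleton_iff_nontrivial] at hL
      have h2 := (Module.supportDim_ne_bot_iff_nontrivial R L).2 hL
      revert h h2
      generalize Module.supportDim R L = w
      intro h h2
      obtain ⟨w, rfl⟩ := WithBot.ne_bot_iff_exists.1 h2
      exact absurd h (not_lt.2 (by
        rw [Nat.cast_zero, ← WithBot.coe_zero, WithBot.coe_le_coe]; exact zero_le))
    exact van_sub _ _
  | succ n ih =>
    revert h
    induction hfin using IsNoetherianRing.induction_on_isQuotientEquivQuotientPrime R with
    | subsingleton N => exact fun _ => van_sub _ _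
    | exact N₁ N₂ N₃ f g hf hg hfg h₁ h₃ =>
      intro h
      exact van_mid hf hg hfg (h₁ ((Module.supportDim_le_of_injective f hf).trans_lt h))
        (h₃ ((Module.supportDim_le_of_surjective g hg).trans_lt h))
    | quotient N p e =>
      intro h
      rw [Module.supportDim_eq_of_equiv e] at h
      refine van_equiv e ?_
      obtain ⟨i, rfl⟩ : ∃ j, i = j + 1 := ⟨i - 1, by omega⟩
      by_cases hp : a ≤ p.1
      · refine tors_van i _ fun y => ⟨1, fun x hx => ?_⟩
        rw [pow_one] at hx
        obtain ⟨y, rfl⟩ := Ideal.Quotient.mk_surjective y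
        rw [Algebra.smul_def, Ideal.Quotient.algebraMap_eq,
          Ideal.Quotient.eq_zero_iff_mem.2 (hp hx), zero_mul]
      · obtain ⟨x, hxa, hxp⟩ := SetLike.not_le_iff_exists.1 hp
        have hprime := p.2
        have hx0 : Ideal.Quotient.mk p.1 x ≠ 0 := fun h => hxp (Ideal.Quotient.eq_zero_iff_mem.1 h)
        let f : (R ⧸ p.1) →ₗ[R] (R ⧸ p.1) := x • LinearMap.id
        have hfx : ∀ y, f y = Ideal.Quotient.mk p.1 x * y := fun y => by
          simp [f, Algebra.smul_def]
        have hf : Function.Injective f := by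
          intro y z hyz
          rw [hfx, hfx] at hyz
          exact mul_left_cancel₀ hx0 hyz
        have hS := se f (LinearMap.range f).mkQ hf
          (Submodule.mkQ_surjective _) (LinearMap.exact_map_mkQ_range f)
        have hr : LinearMap.range f ≠ ⊥ := by
          rw [Submodule.ne_bot_iff]
          exact ⟨f 1, ⟨1, rfl⟩, by rw [hfx, mul_one]; exact hx0⟩
        have hc : Van a i ((R ⧸ p.1) ⧸ LinearMap.range f) :=
          ih _ (dim_aux (quot_dim p.1 _ hr) h) i (by omega)
        have key : ∀ h : H a (i+1) (ModuleCat.of R (R ⧸ p.1)), x • h = 0 → h = 0 := by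
          intro h hh
          refine inj hS (fun h' => ⟨0, by rw [map_zero]; exact (hc h').symm⟩) h ?_
          have := map_smul_id x (𝟙 (ModuleCat.of R (R ⧸ p.1))) h
          rw [CategoryTheory.Functor.map_id] at this
          exact this.trans hh
        intro h
        obtain ⟨k, hk⟩ := pow_kill hxa h
        induction k with
        | zero => simpa using hk
        | succ k ihk =>
          rw [pow_succ', mul_smul] at hk
          exact ihk (key _ hk)

lemma van_of_cd (i : ℕ) (Y : Type u) [AddCommGroup Y] [Module R Y]
    (h : cohDim a Y < (i : ℕ∞)) : Van a i Y := by
  by_contra hv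
  have hm : ((i : ℕ∞) : WithBot ℕ∞) ∈ {n : WithBot ℕ∞ | ∃ i : ℕ, n = (i : ℕ∞) ∧ LCNonzero a i Y} :=
    ⟨i, rfl, (not_van i Y).2 hv⟩
  exact absurd (le_sSup hm) (not_le.2 h)

lemma cd_of_van (d : ℕ) (Y : Type u) [AddCommGroup Y] [Module R Y]
    (h : ∀ i, d ≤ i → Van a i Y) : cohDim a Y < ((d : ℕ∞) : WithBot ℕ∞) := by
  have hlt : ∀ i : ℕ, LCNonzero a i Y → i < d := by
    intro i hi
    by_contra hd
    exact (not_van i Y).1 hi (h i (not_lt.1 hd))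
  cases d with
  | zero =>
    have : cohDim a Y ≤ ⊥ := by
      refine sSup_le ?_
      rintro _ ⟨i, rfl, hi⟩
      exact absurd (hlt i hi) (Nat.not_lt_zero _)
    exact this.trans_lt (WithBot.bot_lt_coe _)
  | succ e =>
    have : cohDim a Y ≤ ((e : ℕ∞) : WithBot ℕ∞) := by
      refine sSup_le ?_
      rintro _ ⟨i, rfl, hi⟩
      have := hlt i hi
      exact_mod_cast (by omega : i ≤ e)
    refine this.trans_lt ?_
    exact_mod_cast (by omega : e < e + 1)

theorem ann_le {M : Type u} [AddCommGroup M] [Module R M] (d : ℕ) (T : Submodule R M)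
    (hT : Van a d T) :
    Module.annihilator R (M ⧸ T) ≤ Module.annihilator R (H a d (ModuleCat.of R M)) := by
  intro y hy
  rw [Module.mem_annihilator] at hy ⊢
  intro h
  let φ : M →ₗ[R] T := (y • LinearMap.id).codRestrict T (fun m => by
    have := hy (T.mkQ m)
    rw [← map_smul] at this
    exact (Submodule.Quotient.mk_eq_zero _).1 this)
  have e : y • 𝟙 (ModuleCat.of R M) = ModuleCat.ofHom φ ≫ ModuleCat.ofHom T.subtype := by
    refine ModuleCat.hom_ext (LinearMap.ext fun m => rfl)
  have h1 := map_smul_id y (𝟙 (ModuleCat.of R M)) h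
  rw [CategoryTheory.Functor.map_id, e, Functor.map_comp] at h1
  refine (h1.symm.trans ?_)
  rw [ConcreteCategory.comp_apply, hT ((localCohomology a d).map (ModuleCat.ofHom φ) h), map_zero]

theorem surj_quot [IsNoetherianRing R] {M : Type u} [AddCommGroup M] [Module R M]
    [Module.Finite R M] (d : ℕ) (hd : Module.supportDim R M < ((d + 1 : ℕ) : WithBot ℕ∞))
    (q : Ideal R) [q.IsPrime] (hq : Module.supportDim R (R ⧸ q) < ((d + 1 : ℕ) : WithBot ℕ∞))
    (g : M →ₗ[R] (R ⧸ q)) (hg : g ≠ 0) (h : H a d (ModuleCat.of R (R ⧸ q))) :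
    ∃ h', (localCohomology a d).map (ModuleCat.ofHom g) h' = h := by
  have hr : LinearMap.range g ≠ ⊥ := by
    rwa [Ne, LinearMap.range_eq_bot]
  have hS1 := se (LinearMap.range g).subtype (LinearMap.range g).mkQ (Submodule.subtype_injective _)
    (Submodule.mkQ_surjective _) (LinearMap.exact_subtype_mkQ _)
  have hS2 := se (LinearMap.ker g).subtype g.rangeRestrict (Submodule.subtype_injective _)
    g.surjective_rangeRestrict (by
      intro y
      rw [← LinearMap.mem_ker, LinearMap.ker_rangeRestrict]
      simp)
  have v1 : Van a d ((R ⧸ q) ⧸ LinearMap.range g) :=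
    van_lt d _ (dim_aux (quot_dim q _ hr) hq) d le_rfl
  have v2 : Van a (d+1) (LinearMap.ker g) :=
    van_lt (d+1) _ ((Module.supportDim_le_of_injective _
      (Submodule.subtype_injective (LinearMap.ker g))).trans_lt hd) (d+1) le_rfl
  obtain ⟨h1, rfl⟩ := sur2 hS1 v1 h
  obtain ⟨h2, rfl⟩ := sur hS2 v2 h1
  refine ⟨h2, ?_⟩
  have e : ModuleCat.ofHom g = ModuleCat.ofHom g.rangeRestrict ≫
      ModuleCat.ofHom (LinearMap.range g).subtype := by
    refine ModuleCat.hom_ext (LinearMap.ext fun m => rfl)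
  rw [e, Functor.map_comp, ConcreteCategory.comp_apply]

theorem ann_le_prime [IsNoetherianRing R] {M : Type u} [AddCommGroup M] [Module R M]
    [Module.Finite R M] (d : ℕ) (hd : Module.supportDim R M < ((d + 1 : ℕ) : WithBot ℕ∞))
    (T : Submodule R M) (hT : cohDim a T < ((d : ℕ∞) : WithBot ℕ∞))
    (hTmax : ∀ L : Submodule R M, cohDim a L < ((d : ℕ∞) : WithBot ℕ∞) → L ≤ T)
    (hTv : ∀ i, d ≤ i → Van a i T)
    (q : Ideal R) (hq : q ∈ (Module.annihilator R (M ⧸ T)).minimalPrimes) :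
    Module.annihilator R (H a d (ModuleCat.of R M)) ≤ q := by
  have hqp : q.IsPrime := hq.1.1
  have hass := Module.associatedPrimes.minimalPrimes_annihilator_subset_associatedPrimes
    (R := R) (M := M ⧸ T) hq
  obtain ⟨j, hj⟩ := (isAssociatedPrime_iff_exists_injective_linearMap q (M ⧸ T)).1 hass |>.2
  have hq1 : Module.supportDim R (R ⧸ q) < ((d + 1 : ℕ) : WithBot ℕ∞) :=
    ((Module.supportDim_le_of_injective j hj).trans
      (Module.supportDim_le_of_surjective T.mkQ (Submodule.mkQ_surjective _))).trans_lt hd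
  have hnv : ¬ Van a d (R ⧸ q) := by
    intro hv
    have hv' : ∀ i, d ≤ i → Van a i (R ⧸ q) := by
      intro i hi
      rcases hi.eq_or_lt with rfl | hi
      · exact hv
      · exact van_lt (d+1) _ hq1 i hi
    let L := (LinearMap.range j).comap T.mkQ
    have hTL : T ≤ L := by
      intro y hy
      change T.mkQ y ∈ LinearMap.range j
      rw [Submodule.mkQ_apply, (Submodule.Quotient.mk_eq_zero _).2 hy]
      exact zero_mem _
    let g : L →ₗ[R] LinearMap.range j := T.mkQ.restrict (fun y hy => hy)
    have hL : ∀ i, d ≤ i → Van a i L := by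
      intro i hi
      refine van_mid (f := Submodule.inclusion hTL) (g := g) (Submodule.inclusion_injective hTL)
        ?_ ?_ (hTv i hi) (van_equiv (LinearEquiv.ofInjective j hj).symm (hv' i hi))
      · rintro ⟨y, hy⟩
        obtain ⟨z, rfl⟩ := Submodule.mkQ_surjective _ y
        exact ⟨⟨z, hy⟩, rfl⟩
      · rintro ⟨y, hy⟩
        constructor
        · intro h
          have h' : T.mkQ y = 0 := congrArg Subtype.val h
          exact ⟨⟨y, (Submodule.Quotient.mk_eq_zero _).1 h'⟩, rfl⟩
        · rintro ⟨z, hz⟩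
          have hz' : (z : M) = y := congrArg Subtype.val hz
          refine Subtype.ext ?_
          change T.mkQ y = 0
          rw [← hz', Submodule.mkQ_apply, (Submodule.Quotient.mk_eq_zero _).2 z.2]
    have hLT := hTmax L (cd_of_van d L hL)
    obtain ⟨z, hz⟩ := Submodule.mkQ_surjective T (j 1)
    have hzL : z ∈ L := ⟨1, hz.symm⟩
    have : j 1 = j 0 := by
      rw [← hz, map_zero, Submodule.mkQ_apply, (Submodule.Quotient.mk_eq_zero _).2 (hLT hzL)]
    exact one_ne_zero (hj this)
  intro x hx
  by_contra hxq
  have hns : ¬ Subsingleton ((M ⧸ T) →ₗ[R] (R ⧸ q)) := by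
    rw [IsSMulRegular.subsingleton_linearMap_iff]
    rintro ⟨r, hr, hreg⟩
    have h1 : Ideal.Quotient.mk q r = 0 := Ideal.Quotient.eq_zero_iff_mem.2 (hq.1.2 hr)
    have : r • (1 : R ⧸ q) = r • (0 : R ⧸ q) := by
      rw [smul_zero, Algebra.smul_def, Ideal.Quotient.algebraMap_eq, h1, zero_mul]
    exact one_ne_zero (hreg this)
  rw [not_subsingleton_iff_nontrivial] at hns
  obtain ⟨g0, hg0⟩ := exists_ne (0 : (M ⧸ T) →ₗ[R] (R ⧸ q))
  let g : M →ₗ[R] (R ⧸ q) := g0.comp T.mkQ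
  have hxg : x • g ≠ 0 := by
    intro h
    refine hg0 (LinearMap.ext fun y => ?_)
    obtain ⟨y, rfl⟩ := Submodule.mkQ_surjective _ y
    have h2 : x • g0 (T.mkQ y) = 0 := LinearMap.congr_fun h y
    rw [Algebra.smul_def, Ideal.Quotient.algebraMap_eq] at h2
    exact (mul_eq_zero.1 h2).resolve_left (fun h => hxq (Ideal.Quotient.eq_zero_iff_mem.1 h))
  refine hnv fun h => ?_
  obtain ⟨h', rfl⟩ := surj_quot d hd q hq1 (x • g) hxg h
  have e := map_smul_id x (ModuleCat.ofHom g) h'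
  refine Eq.trans e ?_
  rw [← map_smul, Module.mem_annihilator.1 hx, map_zero]

end loc
end
end LC

/-- Over a local ring, if `dim M = d` and `H^d_𝔞(M) ≠ 0`, then
`V(Ann_R(H^d_𝔞(M))) = Supp(M ⧸ T_R(𝔞, M))`. -/
theorem stmt_10 {R : Type u} [CommRing R] [IsNoetherianRing R] [IsLocalRing R] (𝔞 : Ideal R)
    (M : Type u) [AddCommGroup M] [Module R M] [Module.Finite R M] [Nontrivial M]
    (d : ℕ) (hd : modDim R M = (d : ℕ∞)) (htop : LCNonzero 𝔞 d M)
    (T : Submodule R M) (hT : cohDim 𝔞 ↥T < (d : ℕ∞))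
    (hTmax : ∀ L : Submodule R M, cohDim 𝔞 ↥L < (d : ℕ∞) → L ≤ T) :
    {p : PrimeSpectrum R |
        Module.annihilator R ((localCohomology 𝔞 d).obj (ModuleCat.of R M)) ≤ p.asIdeal} =
      Module.support R (M ⧸ T) := by
  have hTv : ∀ i, d ≤ i → LC.Van 𝔞 i T := by
    intro i hi
    refine LC.van_of_cd i T (hT.trans_le ?_)
    exact_mod_cast hi
  have hd' : Module.supportDim R M < ((d + 1 : ℕ) : WithBot ℕ∞) := by
    rw [Module.supportDim_eq_ringKrullDim_quotient_annihilator]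
    refine (le_of_eq hd).trans_lt ?_
    exact_mod_cast Nat.lt_succ_self d
  rw [Module.support_eq_zeroLocus]
  ext p
  constructor
  · intro hp
    exact (LC.ann_le d T (hTv d le_rfl)).trans hp
  · intro hp
    obtain ⟨q, hq, hqp⟩ := Ideal.exists_minimalPrimes_le
      (show Module.annihilator R (M ⧸ T) ≤ p.asIdeal from hp)
    exact (LC.ann_le_prime d hd' T hT hTmax hTv q hq).trans hqp
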